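/- arXiv:2301.00132 — 2 statements merged into one kernel-verified Lean document; each statement's English description precedes it below -/
import Mathlib

section
/- Let η be any ball configuration and suppose τ_k(j) < ∞ for some k ∈ ℕ and j ∈ ℕ. Then for every x ∈ ℤ_{≥0}: x ≥ τ_k(j) if and only if m↑_k(x) ≥ j and m↓_k(x) ≥ j. -/
open Finset

namespace BBS

attribute [local instance] Classical.propDecidable

noncomputable section

/-- A ball configuration: `η x ∈ {0,1}`; the sites are `x = 1, 2, ...` and
the index `0` is never used. -/
def IsConf (η : ℕ → ℤ) : Prop := ∀ x, η x = 0 ∨ η x = 1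

/-- The carrier with seat numbers: `W η x k = 𝒲_k(x)` (seats `k = 1, 2, ...`). -/
def W (η : ℕ → ℤ) : ℕ → ℕ → ℤ
  | 0 => fun _ => 0
  | x + 1 => fun k =>
      W η x k
        + η (x + 1) * (1 - W η x k) * ∏ ℓ ∈ Finset.Icc 1 (k - 1), W η x ℓ
        - (1 - η (x + 1)) * W η x k * ∏ ℓ ∈ Finset.Icc 1 (k - 1), (1 - W η x ℓ)

/-- The seat number configuration `η↑_k(x)`. -/
def up (η : ℕ → ℤ) (k x : ℕ) : ℤ :=
  η x * (1 - W η (x - 1) k) * ∏ ℓ ∈ Finset.Icc 1 (k - 1), W η (x - 1) ℓ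

/-- The seat number configuration `η↓_k(x)`. -/
def down (η : ℕ → ℤ) (k x : ℕ) : ℤ :=
  (1 - η x) * W η (x - 1) k * ∏ ℓ ∈ Finset.Icc 1 (k - 1), (1 - W η (x - 1) ℓ)

/-- The record indicator `r(x) = 1 - ∑_{k ∈ ℕ} (η↑_k(x) + η↓_k(x))`. -/
def rcd (η : ℕ → ℤ) (x : ℕ) : ℤ :=
  1 - ∑' k : ℕ, if 1 ≤ k then up η k x + down η k x else 0

/-- `m^σ_k(x) = ∑_{y=1}^x (η^σ_k(y) - η^σ_{k+1}(y))`, generic in the seat family `e`. -/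
def mSeq (e : ℕ → ℕ → ℤ) (k x : ℕ) : ℤ :=
  ∑ y ∈ Finset.Icc 1 x, (e k y - e (k + 1) y)

/-- `m↑_k(x)` -/
def mUp (η : ℕ → ℤ) : ℕ → ℕ → ℤ := mSeq (up η)

/-- `m↓_k(x)` -/
def mDown (η : ℕ → ℤ) : ℕ → ℕ → ℤ := mSeq (down η)

/-- `ξ_k(x) = x - ∑_{ℓ=1}^k ∑_{y=1}^x (η↑_ℓ(y) + η↓_ℓ(y))`. -/
def xi (η : ℕ → ℤ) (k x : ℕ) : ℤ :=
  (x : ℤ) - ∑ ℓ ∈ Finset.Icc 1 k, ∑ y ∈ Finset.Icc 1 x, (up η ℓ y + down η ℓ y)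

/-- `{x : m↑_k(x) ≥ j ∧ m↓_k(x) ≥ j}`; `τ_k(j) < ∞` iff this set is nonempty. -/
def tauSet (η : ℕ → ℤ) (k j : ℕ) : Set ℕ :=
  {x : ℕ | (j : ℤ) ≤ mUp η k x ∧ (j : ℤ) ≤ mDown η k x}

/-- `τ_k(j)` (with junk value `0` when `τ_k(j) = ∞`). -/
def tau (η : ℕ → ℤ) (k j : ℕ) : ℕ := sInf (tauSet η k j)

/-- `ζ_k(i)`, the number of `j` with `τ_k(j) < ∞` at effective position `ξ_k(τ_k(j)) = i`. -/
def zeta (η : ℕ → ℤ) (k : ℕ) (i : ℤ) : ℕ :=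
  Set.ncard {j : ℕ | 1 ≤ j ∧ (tauSet η k j).Nonempty ∧ xi η k (tau η k j) = i}

/-- `{x : ξ_k(x) = i}`; `s_k(i) < ∞` iff this set is nonempty. -/
def sSet (η : ℕ → ℤ) (k : ℕ) (i : ℤ) : Set ℕ := {x : ℕ | xi η k x = i}

/-- `s_k(i)` (with junk value `0` when `s_k(i) = ∞`). -/
def sPos (η : ℕ → ℤ) (k : ℕ) (i : ℤ) : ℕ := sInf (sSet η k i)

/-- The carrier with infinite capacity: `carrier η x = W_∞(x)`. -/
def carrier (η : ℕ → ℤ) : ℕ → ℤ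
  | 0 => 0
  | x + 1 => carrier η x + η (x + 1) - min (1 - η (x + 1)) (carrier η x)

/-- The BBS time evolution `T`. -/
def Tev (η : ℕ → ℤ) (x : ℕ) : ℤ := η x + carrier η (x - 1) - carrier η x

/-- The carrier with capacity `c ∈ ℕ ∪ {∞}`. -/
def carrierC (c : ℕ∞) (η : ℕ → ℤ) : ℕ → ℤ
  | 0 => 0
  | x + 1 =>
      carrierC c η x
        + (if c = ⊤ then η (x + 1)
            else min (η (x + 1)) (((c.toNat : ℕ) : ℤ) - carrierC c η x))
        - min (1 - η (x + 1)) (carrierC c η x)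

/-- The BBS time evolution `T_ℓ` with carrier capacity `ℓ = c`. -/
def TevC (c : ℕ∞) (η : ℕ → ℤ) (x : ℕ) : ℤ :=
  η x + carrierC c η (x - 1) - carrierC c η x

/-- `p^σ_k(x) = x - 2 ∑_{ℓ=1}^k ∑_{y=1}^x η^σ_ℓ(y)`, generic in the seat family `e`. -/
def pSeat (e : ℕ → ℕ → ℤ) (k x : ℕ) : ℤ :=
  (x : ℤ) - 2 * ∑ ℓ ∈ Finset.Icc 1 k, ∑ y ∈ Finset.Icc 1 x, e ℓ y

/-- `t^σ_k(x,j) = max{1 ≤ y ≤ x : m^σ_k(y) = j, η^σ_k(y) = 1}`. -/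
def tmax (e : ℕ → ℕ → ℤ) (k x : ℕ) (j : ℤ) : ℕ :=
  sSup {y : ℕ | 1 ≤ y ∧ y ≤ x ∧ mSeq e k y = j ∧ e k y = 1}

/-- The largest entry of a multiset of integers (junk for the empty multiset). -/
def maxE (s : Multiset ℤ) : ℤ := sSup {a : ℤ | a ∈ s}

/-- The refined rigging algorithm: `rigSeq e x k` is the multiset of entries of the
array `J^σ_k(x)`, where `e = η^σ`. -/
def rigSeq (e : ℕ → ℕ → ℤ) : ℕ → ℕ → Multiset ℤ
  | 0 => fun _ => 0
  | x + 1 =>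
      let J := rigSeq e x
      let k1 := sSup {k : ℕ | 1 ≤ k ∧ e k (x + 1) = 1}
      if k1 = 0 then J
      else fun j =>
        if j = k1 then pSeat e k1 (x + 1) ::ₘ J j
        else if 1 ≤ j ∧ j + 1 = k1 then (J j).erase (maxE (J j))
        else J j

/-- The KKR algorithm: `kkr η x k` is the multiset of rigging entries attached to the
rows of length `k` of the rigged partition `(μ(x), J(x))`. -/
def kkr (η : ℕ → ℤ) : ℕ → ℕ → Multiset ℤ
  | 0 => fun _ => 0
  | x + 1 =>
      let R := kkr η x
      if η (x + 1) = 1 then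
        -- the vacancy `p_k(x)` of the current rigged partition
        let p : ℕ → ℤ := fun k =>
          (x : ℤ) - 2 * ∑' j : ℕ, ((R j).card : ℤ) * min (j : ℤ) (k : ℤ)
        -- the maximal length of a singular row (`0` if there is none)
        let k0 : ℕ := sSup {k : ℕ | 1 ≤ k ∧ p k ∈ R k ∧ ∀ a ∈ R k, a ≤ p k}
        -- the multiplicities of the new partition `μ(x+1)`
        let m' : ℕ → ℤ := fun j =>
          ((R j).card : ℤ) + (if j = k0 + 1 then 1 else 0) - (if 1 ≤ j ∧ j = k0 then 1 else 0)
        -- the vacancy `p_{k0+1}(x+1)` of the new rigged partition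
        let p' : ℤ := ((x : ℤ) + 1) - 2 * ∑' j : ℕ, m' j * min (j : ℤ) ((k0 : ℤ) + 1)
        fun k =>
          if k = k0 + 1 then p' ::ₘ R k
          else if k = k0 then (R k).erase (p k0)
          else R k
      else R

/-- The conjugate partition `λ_k(x)` of `μ(x)` in the KKR algorithm. -/
def lamKKR (η : ℕ → ℤ) (k x : ℕ) : ℤ :=
  ∑' j : ℕ, if k ≤ j then ((kkr η x j).card : ℤ) else 0

/-- The vacancy `p_k(x) = x - 2 ∑_i min{μ_i(x), k}` in the KKR algorithm. -/
def pKKR (η : ℕ → ℤ) (k x : ℕ) : ℤ :=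
  (x : ℤ) - 2 * ∑' j : ℕ, ((kkr η x j).card : ℤ) * min (j : ℤ) (k : ℤ)

/-! Interlacing Young diagrams.  A Young diagram is encoded as the multiset of its
(positive) row lengths. -/

/-- The conjugate partition: `conj μ k = λ_k`, the number of rows of length `≥ k`. -/
def conj (μ : Multiset ℕ) (k : ℕ) : ℕ := (μ.filter (fun r => k ≤ r)).card

/-- `(μ↑, μ↓)` is interlacing: `μ↑_1 ≥ μ↓_1 ≥ μ↑_2 ≥ μ↓_2 ≥ ⋯`, equivalently
`λ↑_k − λ↓_k ∈ {0,1}` for all `k ≥ 1`. -/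
def Interlacing (a b : Multiset ℕ) : Prop :=
  ∀ k, 1 ≤ k → conj b k ≤ conj a k ∧ conj a k ≤ conj b k + 1

/-- `{k ≥ 1 : λ↑_ℓ − λ↓_ℓ = 1 for all 1 ≤ ℓ ≤ k}`. -/
def kUpSet (a b : Multiset ℕ) : Set ℕ :=
  {k : ℕ | 1 ≤ k ∧ ∀ ℓ, 1 ≤ ℓ → ℓ ≤ k → conj a ℓ = conj b ℓ + 1}

/-- `{k ≥ 1 : λ↑_ℓ − λ↓_ℓ = 0 for all 1 ≤ ℓ ≤ k}`. -/
def kDownSet (a b : Multiset ℕ) : Set ℕ :=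
  {k : ℕ | 1 ≤ k ∧ ∀ ℓ, 1 ≤ ℓ → ℓ ≤ k → conj a ℓ = conj b ℓ}

/-- `k↑` (with `sup ∅ = 0`). -/
def kUp (a b : Multiset ℕ) : ℕ := sSup (kUpSet a b)

/-- `k↓` (with `sup ∅ = 0`; junk value `0` also when `k↓ = ∞`, i.e. `μ↑ = μ↓`). -/
def kDown (a b : Multiset ℕ) : ℕ := sSup (kDownSet a b)

/-- Add one box to a row of length `k` (a new row of length `1` is added if `k = 0`). -/
def addBox (μ : Multiset ℕ) (k : ℕ) : Multiset ℕ := (k + 1) ::ₘ μ.erase k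

/-- The interlacing-diagrams algorithm producing `(μ↑(x), μ↓(x))`. -/
def ydPair (η : ℕ → ℤ) : ℕ → Multiset ℕ × Multiset ℕ
  | 0 => (0, 0)
  | x + 1 =>
      let P := ydPair η x
      if η (x + 1) = 1 then (addBox P.1 (kUp P.1 P.2), P.2)
      else if P.1 ≠ P.2 then (P.1, addBox P.2 (kDown P.1 P.2))
      else P

/-! The Takahashi–Satsuma algorithm and the slot configuration.  The state of the
algorithm is the set `C` of crossed-out sites. -/

/-- The sites not yet crossed out. -/
def active (C : Set ℕ) : Set ℕ := {x | 1 ≤ x ∧ x ∉ C}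

/-- The maximal run (of consecutive equal letters among uncrossed sites) containing `x`. -/
def runOf (η : ℕ → ℤ) (C : Set ℕ) (x : ℕ) : Set ℕ :=
  {y | x ∈ active C ∧ y ∈ active C ∧
    ∀ z ∈ active C, min x y ≤ z → z ≤ max x y → η z = η x}

/-- The length of the run containing `x`, in `ℕ∞`. -/
def runLen (η : ℕ → ℤ) (C : Set ℕ) (x : ℕ) : ℕ∞ :=
  if (runOf η C x).Infinite then ⊤ else ((runOf η C x).ncard : ℕ∞)

/-- The first sites of runs qualifying for the TS step: the run has a preceding run and
is at least as long as it. -/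
def qualSet (η : ℕ → ℤ) (C : Set ℕ) : Set ℕ :=
  {b | b ∈ active C ∧ sInf (runOf η C b) = b ∧
    {y ∈ active C | y < b}.Nonempty ∧
    runLen η C (sSup {y ∈ active C | y < b}) ≤ runLen η C b}

/-- The first site of the leftmost qualifying run. -/
def bSel (η : ℕ → ℤ) (C : Set ℕ) : ℕ := sInf (qualSet η C)

/-- The last site of the run preceding the selected run. -/
def prevSel (η : ℕ → ℤ) (C : Set ℕ) : ℕ :=
  sSup {y ∈ active C | y < bSel η C}

/-- The last `k` letters of the preceding run (the whole preceding run, whose length is `k`). -/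
def S1 (η : ℕ → ℤ) (C : Set ℕ) : Set ℕ := runOf η C (prevSel η C)

/-- The first `k` letters of the selected run. -/
def S2 (η : ℕ → ℤ) (C : Set ℕ) : Set ℕ :=
  {y ∈ runOf η C (bSel η C) |
    ({z ∈ runOf η C (bSel η C) | z ≤ y}).ncard ≤ (S1 η C).ncard}

/-- One step of the TS algorithm: cross out the identified soliton (if any run qualifies). -/
def tsStep (η : ℕ → ℤ) (C : Set ℕ) : Set ℕ :=
  if (qualSet η C).Nonempty then C ∪ S1 η C ∪ S2 η C else C

/-- The crossed-out sites after `n` steps of the TS algorithm. -/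
def tsC (η : ℕ → ℤ) : ℕ → Set ℕ
  | 0 => ∅
  | n + 1 => tsStep η (tsC η n)

/-- The slot configuration `ν : ℕ → ℤ_{≥0} ∪ {∞}`: for a `k`-soliton
`γ = {z_1 < ⋯ < z_{2k}}`, `ν(z_l) = ν(z_{l+k}) = l − 1`, and `ν(x) = ∞` for records. -/
def nuTS (η : ℕ → ℤ) (z : ℕ) : ℕ∞ :=
  if _h : ∃ n, z ∈ tsC η (n + 1) ∧ z ∉ tsC η n then
    let n := sInf {n : ℕ | z ∈ tsC η (n + 1) ∧ z ∉ tsC η n}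
    if z ∈ S1 η (tsC η n) then (({w ∈ S1 η (tsC η n) | w < z}).ncard : ℕ∞)
    else (({w ∈ S2 η (tsC η n) | w < z}).ncard : ℕ∞)
  else ⊤

/-- `ξ̃_k(x)`, the number of `k`-slots in `[1,x]`. -/
def xiTS (η : ℕ → ℤ) (k x : ℕ) : ℕ :=
  Set.ncard {y : ℕ | 1 ≤ y ∧ y ≤ x ∧ (k : ℕ∞) ≤ nuTS η y}

/-- `s̃_k(i)`, the position of the `i`-th `k`-slot. -/
def sTS (η : ℕ → ℤ) (k i : ℕ) : ℕ := sInf {x : ℕ | xiTS η k x = i}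

/-- The slot decomposition `ζ̃_k(i)`: the number of `k`-solitons appended to the
`i`-th `k`-slot. -/
def zetaTS (η : ℕ → ℤ) (k i : ℕ) : ℕ :=
  Set.ncard {n : ℕ | (qualSet η (tsC η n)).Nonempty ∧ (S1 η (tsC η n)).ncard = k ∧
    ∀ z ∈ S1 η (tsC η n) ∪ S2 η (tsC η n), sTS η k i ≤ z ∧ z ≤ sTS η k (i + 1) - 1}

end

end BBS

namespace BBS

theorem prod_eq_zero_or_one (f : ℕ → ℤ) (s : Finset ℕ) (hf : ∀ ℓ, f ℓ = 0 ∨ f ℓ = 1) :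
    ∏ ℓ ∈ s, f ℓ = 0 ∨ ∏ ℓ ∈ s, f ℓ = 1 := by
  refine Finset.prod_induction f (fun a => a = 0 ∨ a = 1) ?_ (Or.inr rfl) fun ℓ _ => hf ℓ
  rintro a b (rfl | rfl) (rfl | rfl) <;> simp

theorem W_succ (η : ℕ → ℤ) (x k : ℕ) :
    W η (x + 1) k = W η x k + up η k (x + 1) - down η k (x + 1) := rfl

theorem W_eq_zero_or_one {η : ℕ → ℤ} (hη : IsConf η) (x : ℕ) :
    ∀ k, W η x k = 0 ∨ W η x k = 1 := by
  induction x with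
  | zero => exact fun _ => Or.inl rfl
  | succ x ih =>
    intro k
    have hP := prod_eq_zero_or_one (fun ℓ => W η x ℓ) (Finset.Icc 1 (k - 1)) ih
    have hQ := prod_eq_zero_or_one (fun ℓ => 1 - W η x ℓ) (Finset.Icc 1 (k - 1)) fun ℓ => by
      rcases ih ℓ with h | h <;> simp [h]
    simp only [W]
    rcases hη (x + 1) with h | h <;> rcases ih k with hk | hk <;>
      rcases hP with hP | hP <;> rcases hQ with hQ | hQ <;> simp [h, hk, hP, hQ]

theorem mSeq_succ (e : ℕ → ℕ → ℤ) (k x : ℕ) :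
    mSeq e k (x + 1) = mSeq e k x + (e k (x + 1) - e (k + 1) (x + 1)) :=
  Finset.sum_Icc_succ_top (by omega) _

/-- The difference of the two counts is determined by the current state of the carrier. -/
theorem mUp_sub_mDown (η : ℕ → ℤ) (k x : ℕ) :
    mUp η k x - mDown η k x = W η x k - W η x (k + 1) := by
  induction x with
  | zero => simp [mUp, mDown, mSeq, W]
  | succ x ih =>
    simp only [mUp, mDown, mSeq_succ, W_succ] at ih ⊢
    linarith

theorem min_mUp_mDown_le_succ {η : ℕ → ℤ} (hη : IsConf η) {k : ℕ} (hk : 1 ≤ k) (x : ℕ) :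
    min (mUp η k x) (mDown η k x) ≤ min (mUp η k (x + 1)) (mDown η k (x + 1)) := by
  obtain ⟨k, rfl⟩ : ∃ n, k = n + 1 := ⟨k - 1, by omega⟩
  have hd := mUp_sub_mDown η (k + 1) x
  have hP := prod_eq_zero_or_one (fun ℓ => W η x ℓ) (Finset.Icc 1 k) (W_eq_zero_or_one hη x)
  have hQ := prod_eq_zero_or_one (fun ℓ => 1 - W η x ℓ) (Finset.Icc 1 k) fun ℓ => by
    rcases W_eq_zero_or_one hη x ℓ with h | h <;> simp [h]
  simp only [mUp, mDown, mSeq_succ] at hd ⊢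
  simp only [up, down, Nat.add_sub_cancel,
    Finset.prod_Icc_succ_top (Nat.le_add_left 1 k)] at hd ⊢
  rcases hη (x + 1) with h | h <;> rcases W_eq_zero_or_one hη x (k + 1) with h₁ | h₁ <;>
    rcases W_eq_zero_or_one hη x (k + 1 + 1) with h₂ | h₂ <;>
    rcases hP with hP | hP <;> rcases hQ with hQ | hQ <;>
    simp only [h, h₁, h₂, hP, hQ] at hd ⊢ <;> omega

/-- Proposition 2.1: if `τ_k(j) < ∞` then `x ≥ τ_k(j)` iff
`m↑_k(x) ≥ j` and `m↓_k(x) ≥ j`. -/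
theorem statement6 (η : ℕ → ℤ) (hη : IsConf η) (k j : ℕ) (hk : 1 ≤ k) (hj : 1 ≤ j)
    (hfin : (tauSet η k j).Nonempty) (x : ℕ) :
    tau η k j ≤ x ↔ ((j : ℤ) ≤ mUp η k x ∧ (j : ℤ) ≤ mDown η k x) := by
  have hmono : Monotone fun x => min (mUp η k x) (mDown η k x) :=
    monotone_nat_of_le_succ (min_mUp_mDown_le_succ hη hk)
  refine ⟨fun h => ?_, fun h => Nat.sInf_le h⟩
  exact le_min_iff.mp ((le_min_iff.mpr (Nat.sInf_mem hfin)).trans (hmono h))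

end BBS
end

section
/- Let η be any ball configuration and suppose s_k(i+1) < ∞ for some k ∈ ℕ and i ∈ ℤ_{≥0}. Then for each σ ∈ {↑,↓}, m^σ_k(s_k(i+1)) − m^σ_k(s_k(i)) ≥ 0. -/
open Finset

namespace BBS

attribute [local instance] Classical.propDecidable

end BBS

namespace BBS

theorem prod_zero_or_one {f : ℕ → ℤ} (hf : ∀ ℓ, f ℓ = 0 ∨ f ℓ = 1) (s : Finset ℕ) :
    ∏ ℓ ∈ s, f ℓ = 0 ∨ ∏ ℓ ∈ s, f ℓ = 1 :=
  prod_induction f (fun a => a = 0 ∨ a = 1)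
    (by rintro a b (rfl | rfl) (rfl | rfl) <;> simp) (by simp) (fun ℓ _ => hf ℓ)

theorem prod_one_sub_zero_or_one {f : ℕ → ℤ} (hf : ∀ ℓ, f ℓ = 0 ∨ f ℓ = 1) (s : Finset ℕ) :
    ∏ ℓ ∈ s, (1 - f ℓ) = 0 ∨ ∏ ℓ ∈ s, (1 - f ℓ) = 1 :=
  prod_zero_or_one (fun ℓ => by rcases hf ℓ with h | h <;> simp [h]) s

theorem W_zero_or_one {η : ℕ → ℤ} (hη : IsConf η) (x k : ℕ) : W η x k = 0 ∨ W η x k = 1 := by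
  induction x generalizing k with
  | zero => exact Or.inl rfl
  | succ x ih =>
    rw [W]
    rcases hη (x + 1) with h | h <;> rcases ih k with hw | hw <;>
      rcases prod_zero_or_one ih (Icc 1 (k - 1)) with hP | hP <;>
      rcases prod_one_sub_zero_or_one ih (Icc 1 (k - 1)) with hQ | hQ <;> simp [h, hw, hP, hQ]

theorem one_sub_sum_up_add_down (η : ℕ → ℤ) (k x : ℕ) :
    1 - ∑ ℓ ∈ Icc 1 k, (up η ℓ (x + 1) + down η ℓ (x + 1)) =
      η (x + 1) * ∏ ℓ ∈ Icc 1 k, W η x ℓ + (1 - η (x + 1)) * ∏ ℓ ∈ Icc 1 k, (1 - W η x ℓ) := by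
  induction k with
  | zero => simp
  | succ k ih =>
    rw [sum_Icc_succ_top (by omega), prod_Icc_succ_top (by omega), prod_Icc_succ_top (by omega),
      ← sub_sub, ih]
    simp only [up, down, Nat.add_sub_cancel]
    ring

theorem xi_succ (η : ℕ → ℤ) (k x : ℕ) :
    xi η k (x + 1) = xi η k x + (η (x + 1) * ∏ ℓ ∈ Icc 1 k, W η x ℓ
      + (1 - η (x + 1)) * ∏ ℓ ∈ Icc 1 k, (1 - W η x ℓ)) := by
  rw [← one_sub_sum_up_add_down]
  simp only [xi, sum_Icc_succ_top (Nat.le_add_left 1 x), sum_add_distrib]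
  push_cast
  ring

/-- A step either leaves `ξ_k` unchanged, in which case `m↑_k` and `m↓_k` do not decrease, or
raises `ξ_k` by one, in which case `m↑_k` and `m↓_k` agree afterwards and at least one of them
does not decrease. -/
theorem xi_step {η : ℕ → ℤ} (hη : IsConf η) {k : ℕ} (hk : 1 ≤ k) (x : ℕ) :
    (xi η k (x + 1) = xi η k x ∧ mUp η k x ≤ mUp η k (x + 1) ∧
      mDown η k x ≤ mDown η k (x + 1)) ∨
    (xi η k (x + 1) = xi η k x + 1 ∧ mUp η k (x + 1) = mDown η k (x + 1) ∧
      (mUp η k x ≤ mUp η k (x + 1) ∨ mDown η k x ≤ mDown η k (x + 1))) := by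
  obtain ⟨n, rfl⟩ : ∃ n, k = n + 1 := ⟨k - 1, by omega⟩
  have hdiff := mUp_sub_mDown η (n + 1) (x + 1)
  rw [W_succ, W_succ] at hdiff
  rw [xi_succ]
  simp only [mUp, mDown, mSeq_succ] at hdiff ⊢
  simp only [up, down, Nat.add_sub_cancel] at hdiff ⊢
  simp only [prod_Icc_succ_top (Nat.le_add_left 1 n)] at hdiff ⊢
  rcases hη (x + 1) with h | h <;> rcases W_zero_or_one hη x (n + 1) with hw | hw <;>
    rcases W_zero_or_one hη x (n + 1 + 1) with hv | hv <;>
    rcases prod_zero_or_one (W_zero_or_one hη x) (Icc 1 n) with hP | hP <;>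
    rcases prod_one_sub_zero_or_one (W_zero_or_one hη x) (Icc 1 n) with hQ | hQ <;>
    simp only [h, hw, hv, hP, hQ] at hdiff ⊢ <;> omega

theorem xi_monotone {η : ℕ → ℤ} (hη : IsConf η) {k : ℕ} (hk : 1 ≤ k) : Monotone (xi η k) :=
  monotone_nat_of_le_succ fun x => by rcases xi_step hη hk x with h | h <;> omega

theorem xi_zero (η : ℕ → ℤ) (k : ℕ) : xi η k 0 = 0 := by simp [xi]

theorem xi_sPos {η : ℕ → ℤ} {k : ℕ} {i : ℤ} (h : (sSet η k i).Nonempty) :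
    xi η k (sPos η k i) = i :=
  Nat.sInf_mem h

theorem sPos_le {η : ℕ → ℤ} {k x : ℕ} {i : ℤ} (h : xi η k x = i) : sPos η k i ≤ x :=
  Nat.sInf_le h

theorem mUp_sPos_eq_mDown_sPos {η : ℕ → ℤ} (hη : IsConf η) {k : ℕ} (hk : 1 ≤ k) {i : ℤ}
    (h : (sSet η k i).Nonempty) : mUp η k (sPos η k i) = mDown η k (sPos η k i) := by
  have hxi := xi_sPos h
  rcases hs : sPos η k i with _ | a
  · simp [mUp, mDown, mSeq]
  · rw [hs] at hxi
    rcases xi_step hη hk a with h1 | h1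
    · have := sPos_le (h1.1.symm.trans hxi)
      omega
    · exact h1.2.1

/-- Just before the first site where `ξ_k = i + 1`, with `i ≥ 0`, one has `ξ_k = i`. -/
theorem exists_sPos_succ_eq {η : ℕ → ℤ} (hη : IsConf η) {k : ℕ} (hk : 1 ≤ k) {i : ℤ}
    (hi : 0 ≤ i) (h : (sSet η k (i + 1)).Nonempty) :
    ∃ b, sPos η k (i + 1) = b + 1 ∧ xi η k b = i := by
  have hxi := xi_sPos h
  rcases hs : sPos η k (i + 1) with _ | b
  · rw [hs, xi_zero] at hxi
    omega
  · rw [hs] at hxi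
    refine ⟨b, rfl, ?_⟩
    rcases xi_step hη hk b with h1 | h1
    · have := sPos_le (h1.1.symm.trans hxi)
      omega
    · omega

theorem mUp_mDown_le_of_xi_eq {η : ℕ → ℤ} (hη : IsConf η) {k : ℕ} (hk : 1 ≤ k) {a b : ℕ}
    (hab : a ≤ b) (h : xi η k b = xi η k a) :
    mUp η k a ≤ mUp η k b ∧ mDown η k a ≤ mDown η k b := by
  induction b, hab using Nat.le_induction with
  | base => exact ⟨le_rfl, le_rfl⟩
  | succ b hab ih =>
    have := xi_monotone hη hk hab
    rcases xi_step hη hk b with h1 | h1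
    · have := ih (by omega)
      omega
    · omega

/-- Lemma 3.8: if `s_k(i+1) < ∞` then `m^σ_k(s_k(i+1)) − m^σ_k(s_k(i)) ≥ 0`
for each `σ ∈ {↑,↓}`. -/
theorem statement8 (η : ℕ → ℤ) (hη : IsConf η) (k : ℕ) (hk : 1 ≤ k) (i : ℤ) (hi : 0 ≤ i)
    (hfin : (sSet η k (i + 1)).Nonempty) :
    mUp η k (sPos η k i) ≤ mUp η k (sPos η k (i + 1)) ∧
    mDown η k (sPos η k i) ≤ mDown η k (sPos η k (i + 1)) := by
  obtain ⟨b, hb, hxb⟩ := exists_sPos_succ_eq hη hk hi hfin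
  have hne : (sSet η k i).Nonempty := ⟨b, hxb⟩
  have hle := mUp_mDown_le_of_xi_eq hη hk (sPos_le hxb) (hxb.trans (xi_sPos hne).symm)
  have heq := mUp_sPos_eq_mDown_sPos hη hk hne
  have hxs := xi_sPos hfin
  rw [hb] at hxs ⊢
  rcases xi_step hη hk b with h | h <;> omega

end BBS
end
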